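/- arXiv:1810.06007 — 2 statements merged into one kernel-verified Lean document; each statement's English description precedes it below -/
import Mathlib

section
/- Let α = 2^{1/3} (the real cube root of 2), set b1 = b3 = (4 + 2α + α²)/6, b2 = −(1 + 2α + α²)/3, c1 = b1/2 = (4 + 2α + α²)/12, c2 = 1/2, c3 = 1 − c1, and take the coefficient matrix A = [[b1/2, 0, 0], [b1, b2/2, 0], [b1, b2, b1/2]]. Then these coefficients satisfy all the fourth-order conditions: a_{i1} + a_{i2} + a_{i3} = c_i for i = 1,2,3; b1 + b2 + b3 = 1; ∑_i b_i·c_i = 1/2; ∑_i b_i·c_i² = 1/3; ∑_i b_i·c_i³ = 1/4; ∑_i b_i·(∑_j a_{ij}·c_j) = 1/6; ∑_i b_i·c_i·(∑_j a_{ij}·c_j) = 1/8; ∑_i b_i·(∑_j a_{ij}·c_j²) = 1/12; and ∑_{i,j} b_i·a_{ij}·(∑_k a_{jk}·c_k) = 1/24. -/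
/-- The coefficients of the three-stage symmetric and symplectic method
underlying SSSEI3s4 (with `α = 2^{1/3}`) satisfy all the fourth-order
conditions. -/
theorem SSSEI3s4_fourth_order_conditions
    (α b1 b2 b3 c1 c2 c3 a11 a12 a13 a21 a22 a23 a31 a32 a33 : ℝ)
    (hα : α = (2 : ℝ) ^ ((1 : ℝ) / 3))
    (hb1 : b1 = (4 + 2 * α + α ^ 2) / 6) (hb3 : b3 = b1)
    (hb2 : b2 = -(1 + 2 * α + α ^ 2) / 3)
    (hc1 : c1 = b1 / 2) (hc2 : c2 = 1 / 2) (hc3 : c3 = 1 - c1)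
    (ha11 : a11 = b1 / 2) (ha12 : a12 = 0) (ha13 : a13 = 0)
    (ha21 : a21 = b1) (ha22 : a22 = b2 / 2) (ha23 : a23 = 0)
    (ha31 : a31 = b1) (ha32 : a32 = b2) (ha33 : a33 = b1 / 2) :
    a11 + a12 + a13 = c1 ∧ a21 + a22 + a23 = c2 ∧ a31 + a32 + a33 = c3
    ∧ b1 + b2 + b3 = 1
    ∧ b1 * c1 + b2 * c2 + b3 * c3 = 1 / 2
    ∧ b1 * c1 ^ 2 + b2 * c2 ^ 2 + b3 * c3 ^ 2 = 1 / 3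
    ∧ b1 * c1 ^ 3 + b2 * c2 ^ 3 + b3 * c3 ^ 3 = 1 / 4
    ∧ b1 * (a11 * c1 + a12 * c2 + a13 * c3)
      + b2 * (a21 * c1 + a22 * c2 + a23 * c3)
      + b3 * (a31 * c1 + a32 * c2 + a33 * c3) = 1 / 6
    ∧ b1 * c1 * (a11 * c1 + a12 * c2 + a13 * c3)
      + b2 * c2 * (a21 * c1 + a22 * c2 + a23 * c3)
      + b3 * c3 * (a31 * c1 + a32 * c2 + a33 * c3) = 1 / 8
    ∧ b1 * (a11 * c1 ^ 2 + a12 * c2 ^ 2 + a13 * c3 ^ 2)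
      + b2 * (a21 * c1 ^ 2 + a22 * c2 ^ 2 + a23 * c3 ^ 2)
      + b3 * (a31 * c1 ^ 2 + a32 * c2 ^ 2 + a33 * c3 ^ 2) = 1 / 12
    ∧ b1 * a11 * (a11 * c1 + a12 * c2 + a13 * c3)
      + b1 * a12 * (a21 * c1 + a22 * c2 + a23 * c3)
      + b1 * a13 * (a31 * c1 + a32 * c2 + a33 * c3)
      + b2 * a21 * (a11 * c1 + a12 * c2 + a13 * c3)
      + b2 * a22 * (a21 * c1 + a22 * c2 + a23 * c3)
      + b2 * a23 * (a31 * c1 + a32 * c2 + a33 * c3)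
      + b3 * a31 * (a11 * c1 + a12 * c2 + a13 * c3)
      + b3 * a32 * (a21 * c1 + a22 * c2 + a23 * c3)
      + b3 * a33 * (a31 * c1 + a32 * c2 + a33 * c3) = 1 / 24 := by
  have h3 : α ^ 3 = 2 := by
    rw [hα, ← Real.rpow_natCast, ← Real.rpow_mul (by norm_num)]
    norm_num
  have hb2' : b2 = 1 - 2 * b1 := by rw [hb2, hb1]; ring
  have hc : 6 * b1 ^ 3 - 12 * b1 ^ 2 + 6 * b1 - 1 = 0 := by
    rw [hb1]
    clear * - h3
    grind
  clear hb1 hb2 hα h3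
  subst hb3 hc3 hc1 hc2 ha11 ha12 ha13 ha21 ha22 ha23 ha31 ha32 ha33 hb2'
  refine ⟨?_, ?_, ?_, ?_, ?_, ?_, ?_, ?_, ?_, ?_, ?_⟩ <;> grind
end

section
/- Let r ∈ ℝ and let x1, x2 : ℝ → ℝ be differentiable functions satisfying the averaged wind-induced oscillation system in the undamped case θ = π/2 (so ζ = 0, λ = r): x1'(t) = −r·x2(t) + x1(t)·x2(t) and x2'(t) = r·x1(t) + (1/2)·(x1(t)² − x2(t)²), for all t. Then the first integral H(t) = (1/2)·r·(x1(t)² + x2(t)²) − (1/2)·(x1(t)·x2(t)² − (1/3)·x1(t)³) is constant: for all t1, t2 ∈ ℝ, H(t1) = H(t2) (equivalently, the derivative of t ↦ H(t) vanishes identically). -/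
/-- First-integral conservation for the averaged wind-induced oscillation
system in the undamped case `θ = π/2`: along any solution of
`x1' = −r·x2 + x1·x2`, `x2' = r·x1 + (x1² − x2²)/2`, the quantity
`H = r(x1² + x2²)/2 − (x1·x2² − x1³/3)/2` is constant. -/
theorem wind_induced_oscillation_first_integral
    (r : ℝ) (x1 x2 : ℝ → ℝ)
    (h1 : ∀ t, HasDerivAt x1 (-r * x2 t + x1 t * x2 t) t)
    (h2 : ∀ t, HasDerivAt x2 (r * x1 t + (1 / 2) * (x1 t ^ 2 - x2 t ^ 2)) t) :
    ∀ t1 t2 : ℝ,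
      (1 / 2) * r * (x1 t1 ^ 2 + x2 t1 ^ 2)
          - (1 / 2) * (x1 t1 * x2 t1 ^ 2 - (1 / 3) * x1 t1 ^ 3)
        = (1 / 2) * r * (x1 t2 ^ 2 + x2 t2 ^ 2)
          - (1 / 2) * (x1 t2 * x2 t2 ^ 2 - (1 / 3) * x1 t2 ^ 3) := by
  have key : ∀ t, HasDerivAt (fun t => (1 / 2) * r * (x1 t ^ 2 + x2 t ^ 2)
      - (1 / 2) * (x1 t * x2 t ^ 2 - (1 / 3) * x1 t ^ 3)) 0 t := by
    intro t
    have h := ((((h1 t).pow 2).add ((h2 t).pow 2)).const_mul ((1 / 2) * r)).sub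
      ((((h1 t).mul ((h2 t).pow 2)).sub (((h1 t).pow 3).const_mul (1 / 3))).const_mul (1 / 2))
    refine HasDerivAt.congr_deriv h ?_
    simp only [Pi.pow_apply]
    push_cast
    ring
  intro t1 t2
  exact is_const_of_deriv_eq_zero (fun t => (key t).differentiableAt) (fun t => (key t).deriv) t1 t2
end
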